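/- Let k ≥ 2 and let (M_n) be a sequence of integers with 1 ≤ M_n ≤ kn−1 and M_n/(kn) → c for some c ∈ (0,1). Then lim_{n→∞} P_{n,k}(S⁺(n,k;M_n)) = −(1−(1−c)^k)·log(1−(1−c)^k). -/

import Mathlib

open Finset Filter

open scoped Classical

/-- The sample space `Ω_{n,k}`: sequences of length `k*n` with values in `Fin n`
(the value `v : Fin n` encodes the rank `v+1`), in which each value appears exactly `k`
times; these are the permutations of the multiset `{1^k, 2^k, …, n^k}`. -/
def multisetPerms (n k : ℕ) : Finset (Fin (k*n) → Fin n) :=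
  Finset.univ.filter (fun w => ∀ v : Fin n, (Finset.univ.filter (fun i => w i = v)).card = k)

/-- The maximum (as a `0`-based value) among the first `M` entries of `w`. -/
def firstMax (n k M : ℕ) (w : Fin (k*n) → Fin n) : ℕ :=
  (Finset.univ.filter (fun t : Fin (k*n) => (t : ℕ) < M)).sup (fun t => (w t : ℕ))

/-- The strategy `S(n,k;M)` succeeds on `w`: there is an index `i` beyond the first `M`
entries whose value is `≥` the maximum of the first `M` entries, and the first such index
carries an item of the highest rank `n`. -/
def succeedsS (n k M : ℕ) (w : Fin (k*n) → Fin n) : Prop :=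
  ∃ i : Fin (k*n), M ≤ (i : ℕ) ∧ firstMax n k M w ≤ (w i : ℕ) ∧
    (∀ i' : Fin (k*n), M ≤ (i' : ℕ) → firstMax n k M w ≤ (w i' : ℕ) → i ≤ i') ∧
    (w i : ℕ) + 1 = n

/-- The strategy `S⁺(n,k;M)` succeeds on `w`: there is an index `i` beyond the first `M`
entries whose value is strictly greater than the maximum of the first `M` entries, and the
first such index carries an item of the highest rank `n`. -/
def succeedsSplus (n k M : ℕ) (w : Fin (k*n) → Fin n) : Prop :=
  ∃ i : Fin (k*n), M ≤ (i : ℕ) ∧ firstMax n k M w < (w i : ℕ) ∧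
    (∀ i' : Fin (k*n), M ≤ (i' : ℕ) → firstMax n k M w < (w i' : ℕ) → i ≤ i') ∧
    (w i : ℕ) + 1 = n

/-- `P_{n,k}(S(n,k;M))`: the probability of success of strategy `S(n,k;M)` under the
uniform measure on `Ω_{n,k}`. -/
noncomputable def probS (n k M : ℕ) : ℝ :=
  (((multisetPerms n k).filter (succeedsS n k M)).card : ℝ) / ((multisetPerms n k).card : ℝ)

/-- `P_{n,k}(S⁺(n,k;M))`: the probability of success of strategy `S⁺(n,k;M)` under the
uniform measure on `Ω_{n,k}`. -/
noncomputable def probSplus (n k M : ℕ) : ℝ :=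
  (((multisetPerms n k).filter (succeedsSplus n k M)).card : ℝ) / ((multisetPerms n k).card : ℝ)

/-- The event `A^{(n)}_{M,j,l}`: among the first `M` entries, the rank `j` appears exactly
`l` times and no rank greater than `j` appears. -/
def eventA (n k M j l : ℕ) (w : Fin (k*n) → Fin n) : Prop :=
  ((Finset.univ.filter (fun i : Fin (k*n) => (i : ℕ) < M ∧ (w i : ℕ) + 1 = j)).card = l) ∧
  ∀ i : Fin (k*n), (i : ℕ) < M → (w i : ℕ) + 1 ≤ j

/-- The sequences in `Ω_{n,k}` whose first `M` entries avoid the `r` highest ranks. -/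
noncomputable def avoidTop (n k M r : ℕ) : Finset (Fin (k*n) → Fin n) :=
  (multisetPerms n k).filter (fun w => ∀ i : Fin (k*n), (i : ℕ) < M → (w i : ℕ) + r < n)

/-- The first entry beyond position `M` which exceeds the first `M` entries has value `v`. -/
def firstExceedsAt (n k M : ℕ) (w : Fin (k*n) → Fin n) (v : Fin n) : Prop :=
  ∃ i : Fin (k*n), M ≤ (i : ℕ) ∧ firstMax n k M w < (w i : ℕ) ∧
    (∀ i' : Fin (k*n), M ≤ (i' : ℕ) → firstMax n k M w < (w i' : ℕ) → i ≤ i') ∧ w i = v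

/-- The sequences in `Ω_{n,k}` whose first `M` entries have maximum `j`. -/
noncomputable def firstMaxEq (n k M j : ℕ) : Finset (Fin (k*n) → Fin n) :=
  (multisetPerms n k).filter (fun w => firstMax n k M w = j)

lemma mem_multisetPerms {n k : ℕ} {w : Fin (k*n) → Fin n} :
    w ∈ multisetPerms n k ↔ ∀ v : Fin n, (univ.filter (fun i => w i = v)).card = k := by
  simp [multisetPerms]

lemma multisetPerms_nonempty (n k : ℕ) : (multisetPerms n k).Nonempty := by
  refine ⟨fun i => (finProdFinEquiv.symm i).2, mem_multisetPerms.2 fun v => ?_⟩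
  have h : (univ.filter (fun i : Fin (k*n) => (finProdFinEquiv.symm i).2 = v)) =
      (univ : Finset (Fin k)).map
        ⟨fun a => finProdFinEquiv (a, v), fun a b hab => by simpa using hab⟩ := by
    ext i
    obtain ⟨⟨a, b⟩, rfl⟩ := finProdFinEquiv.surjective i
    simp only [Equiv.symm_apply_apply, Finset.mem_map, mem_filter, mem_univ, true_and]
    constructor
    · rintro rfl
      exact ⟨a, rfl⟩
    · rintro ⟨a', h⟩
      exact (congrArg Prod.snd (finProdFinEquiv.injective h)).symm
  rw [h, card_map, card_univ, Fintype.card_fin]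

lemma multisetPerms_comp_perm {n k : ℕ} {w : Fin (k*n) → Fin n} (hw : w ∈ multisetPerms n k)
    (σ : Equiv.Perm (Fin (k*n))) : w ∘ σ ∈ multisetPerms n k := by
  rw [mem_multisetPerms] at hw ⊢
  intro v
  exact (card_equiv σ (by simp)).trans (hw v)

lemma multisetPerms_perm_comp {n k : ℕ} {w : Fin (k*n) → Fin n} (hw : w ∈ multisetPerms n k)
    (σ : Equiv.Perm (Fin n)) : σ ∘ w ∈ multisetPerms n k := by
  rw [mem_multisetPerms] at hw ⊢
  intro v
  refine Eq.trans ?_ (hw (σ.symm v))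
  simp [Equiv.eq_symm_apply]

/-- The positions of the `r` highest ranks. -/
noncomputable def topPositions (n k r : ℕ) (w : Fin (k*n) → Fin n) : Finset (Fin (k*n)) :=
  univ.filter (fun i => n ≤ (w i : ℕ) + r)

lemma card_topPositions {n k r : ℕ} (hr : r ≤ n) {w : Fin (k*n) → Fin n}
    (hw : w ∈ multisetPerms n k) : (topPositions n k r w).card = k * r := by
  rw [mem_multisetPerms] at hw
  have hT : (univ.filter (fun v : Fin n => n ≤ (v : ℕ) + r)).card = r := by
    have h : (univ.filter (fun v : Fin n => n ≤ (v : ℕ) + r)).map Fin.valEmbedding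
        = Ico (n - r) n := by
      ext x
      simp only [Finset.mem_map, mem_filter, mem_univ, true_and, Fin.valEmbedding_apply, mem_Ico]
      constructor
      · rintro ⟨v, hv, rfl⟩
        have := v.2
        omega
      · rintro ⟨h1, h2⟩
        exact ⟨⟨x, h2⟩, by simp only; omega, rfl⟩
    rw [← card_map Fin.valEmbedding, h, Nat.card_Ico]
    omega
  rw [card_eq_sum_card_fiberwise (f := w)
    (t := univ.filter (fun v : Fin n => n ≤ (v : ℕ) + r))
    (by intro i hi; simpa [topPositions] using hi)]
  rw [sum_congr rfl (g := fun _ => k), sum_const, hT, smul_eq_mul, mul_comm]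
  intro v hv
  refine Eq.trans ?_ (hw v)
  congr 1
  ext i
  simp only [topPositions, mem_filter, mem_univ, true_and] at hv ⊢
  constructor
  · exact fun h => h.2
  · rintro rfl
    exact ⟨hv, rfl⟩

lemma exists_perm_mem_iff {α : Type*} [Fintype α] {S T : Finset α}
    (h : S.card = T.card) : ∃ σ : Equiv.Perm α, ∀ i, σ i ∈ T ↔ i ∈ S := by
  let e : {x // x ∈ S} ≃ {x // x ∈ T} := Finset.equivOfCardEq h
  refine ⟨e.extendSubtype, fun i => ⟨fun hi => ?_, fun hi => ?_⟩⟩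
  · by_contra hS
    exact e.extendSubtype_not_mem i hS hi
  · exact e.extendSubtype_mem i hi

lemma card_topPositions_fiber_le {n k r : ℕ} {S T : Finset (Fin (k*n))} (h : S.card = T.card) :
    ((multisetPerms n k).filter (fun w => topPositions n k r w = S)).card ≤
      ((multisetPerms n k).filter (fun w => topPositions n k r w = T)).card := by
  obtain ⟨σ, hσ⟩ := exists_perm_mem_iff h.symm
  refine card_le_card_of_injOn (fun w => w ∘ σ) ?_ ?_
  · intro w hw
    simp only [coe_filter, Set.mem_ofPred_eq] at hw ⊢
    refine ⟨multisetPerms_comp_perm hw.1 σ, ?_⟩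
    ext i
    rw [← hσ i, ← hw.2]
    simp [topPositions]
  · intro w _ w' _ hww
    exact σ.surjective.injective_comp_right hww

lemma card_topPositions_fiber {n k r : ℕ} {S T : Finset (Fin (k*n))} (h : S.card = T.card) :
    ((multisetPerms n k).filter (fun w => topPositions n k r w = S)).card =
      ((multisetPerms n k).filter (fun w => topPositions n k r w = T)).card :=
  le_antisymm (card_topPositions_fiber_le h) (card_topPositions_fiber_le h.symm)

lemma card_ge_positions (n k M : ℕ) :
    (univ.filter (fun i : Fin (k*n) => M ≤ (i : ℕ))).card = k*n - M := by
  have h : (univ.filter (fun i : Fin (k*n) => M ≤ (i : ℕ))).map Fin.valEmbedding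
      = Ico M (k*n) := by
    ext x
    simp only [Finset.mem_map, mem_filter, mem_univ, true_and, Fin.valEmbedding_apply, mem_Ico]
    constructor
    · rintro ⟨v, hv, rfl⟩
      exact ⟨hv, v.2⟩
    · rintro ⟨h1, h2⟩
      exact ⟨⟨x, h2⟩, h1, rfl⟩
  rw [← card_map Fin.valEmbedding, h, Nat.card_Ico]

lemma card_avoidTop_mul {n k M r : ℕ} (hr : r ≤ n) :
    (avoidTop n k M r).card * (k*n).choose (k*r) =
      (multisetPerms n k).card * (k*n - M).choose (k*r) := by
  have hle : k * r ≤ (univ : Finset (Fin (k*n))).card := by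
    rw [card_univ, Fintype.card_fin]
    exact Nat.mul_le_mul_left k hr
  obtain ⟨S₀, -, hS₀⟩ := exists_subset_card_eq hle
  set f := ((multisetPerms n k).filter (fun w => topPositions n k r w = S₀)).card with hf
  have h1 : (multisetPerms n k).card = (k*n).choose (k*r) * f := by
    rw [card_eq_sum_card_fiberwise (f := topPositions n k r)
      (t := powersetCard (k*r) (univ : Finset (Fin (k*n))))
      (by intro w hw; simpa [mem_powersetCard] using card_topPositions hr hw)]
    rw [sum_congr rfl (g := fun _ => f), sum_const, card_powersetCard, card_univ,
      Fintype.card_fin, smul_eq_mul]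
    intro S hS
    exact card_topPositions_fiber ((mem_powersetCard.1 hS).2.trans hS₀.symm)
  have h2 : (avoidTop n k M r).card = (k*n - M).choose (k*r) * f := by
    rw [card_eq_sum_card_fiberwise (f := topPositions n k r)
      (t := powersetCard (k*r) (univ.filter (fun i : Fin (k*n) => M ≤ (i : ℕ))))]
    · rw [sum_congr rfl (g := fun _ => f), sum_const, card_powersetCard, card_ge_positions,
        smul_eq_mul]
      intro S hS
      rw [mem_powersetCard] at hS
      rw [hf, ← card_topPositions_fiber (hS.2.trans hS₀.symm)]
      congr 1
      ext w
      simp only [avoidTop, mem_filter, and_assoc, and_congr_right_iff, and_iff_right_iff_imp]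
      rintro - rfl i hi
      by_contra hcon
      have := hS.1 (show i ∈ topPositions n k r w by simpa [topPositions] using hcon)
      simp at this
      omega
    · intro w hw
      simp only [avoidTop, coe_filter, Set.mem_ofPred_eq] at hw
      rw [mem_coe, mem_powersetCard]
      refine ⟨fun i hi => ?_, card_topPositions hr hw.1⟩
      simp only [topPositions, mem_filter, mem_univ, true_and] at hi ⊢
      by_contra hcon
      have := hw.2 i (by omega)
      omega
  rw [h1, h2]
  ring

/-- The probability that a uniform `k*r`-subset of `k*n` positions avoids the first `M`. -/
noncomputable def avoidProb (n k M r : ℕ) : ℝ :=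
  ((k*n - M).choose (k*r) : ℝ) / ((k*n).choose (k*r) : ℝ)

lemma card_avoidTop {n k M r : ℕ} (hr : r ≤ n) :
    ((avoidTop n k M r).card : ℝ) = (multisetPerms n k).card * avoidProb n k M r := by
  have h : 0 < (k*n).choose (k*r) := Nat.choose_pos (Nat.mul_le_mul_left k hr)
  have h' : ((k*n).choose (k*r) : ℝ) ≠ 0 := by exact_mod_cast h.ne'
  rw [avoidProb, ← mul_div_assoc, eq_div_iff h']
  exact_mod_cast card_avoidTop_mul hr

lemma le_firstMax {n k M : ℕ} (w : Fin (k*n) → Fin n) {i : Fin (k*n)} (hi : (i : ℕ) < M) :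
    (w i : ℕ) ≤ firstMax n k M w :=
  le_sup (f := fun t => (w t : ℕ)) (by simpa using hi)

lemma exists_firstMax_eq {n k M : ℕ} (hM : 1 ≤ M) (hM' : M ≤ k*n) (w : Fin (k*n) → Fin n) :
    ∃ i : Fin (k*n), (i : ℕ) < M ∧ (w i : ℕ) = firstMax n k M w := by
  obtain ⟨i, hi, h⟩ := exists_mem_eq_sup
    (univ.filter (fun t : Fin (k*n) => (t : ℕ) < M)) ⟨⟨0, by omega⟩, by simpa using Nat.lt_of_lt_of_le Nat.zero_lt_one hM⟩
    (fun t => (w t : ℕ))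
  exact ⟨i, by simpa using hi, h.symm⟩

lemma card_firstMaxEq {n k M j r : ℕ} (hM : 1 ≤ M) (hM' : M ≤ k*n) (h : j + r + 1 = n) :
    ((firstMaxEq n k M j).card : ℝ) =
      (multisetPerms n k).card * (avoidProb n k M r - avoidProb n k M (r + 1)) := by
  have hsub : avoidTop n k M (r + 1) ⊆ avoidTop n k M r := by
    intro w hw
    simp only [avoidTop, mem_filter] at hw ⊢
    exact ⟨hw.1, fun i hi => by have := hw.2 i hi; omega⟩
  have heq : firstMaxEq n k M j = avoidTop n k M r \ avoidTop n k M (r + 1) := by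
    ext w
    simp only [firstMaxEq, avoidTop, Finset.mem_sdiff, mem_filter]
    obtain ⟨i₀, hi₀, hw₀⟩ := exists_firstMax_eq hM hM' w
    constructor
    · rintro ⟨hw, hj⟩
      refine ⟨⟨hw, fun i hi => ?_⟩, fun hcon => ?_⟩
      · have := le_firstMax w hi
        omega
      · have := hcon.2 i₀ hi₀
        omega
    · rintro ⟨⟨hw, h1⟩, h2⟩
      refine ⟨hw, ?_⟩
      have := h1 i₀ hi₀
      by_contra hne
      refine h2 ⟨hw, fun i hi => ?_⟩
      have := le_firstMax w hi
      omega
  rw [heq, card_sdiff_of_subset hsub, Nat.cast_sub (card_le_card hsub),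
    card_avoidTop (by omega), card_avoidTop (by omega)]
  ring

lemma firstMax_swap_comp {n k M : ℕ} (w : Fin (k*n) → Fin n) {u v : Fin n}
    (hu : firstMax n k M w < u) (hv : firstMax n k M w < v) :
    firstMax n k M (Equiv.swap u v ∘ w) = firstMax n k M w := by
  unfold firstMax
  refine sup_congr rfl fun i hi => ?_
  have hi' := le_firstMax (M := M) w (i := i) (by simpa using hi)
  rw [Function.comp_apply, Equiv.swap_apply_of_ne_of_ne]
  · rintro rfl
    omega
  · rintro rfl
    omega

lemma lt_swap_iff {n j : ℕ} {u v : Fin n} (hu : j < u) (hv : j < v) (x : Fin n) :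
    j < (Equiv.swap u v x : ℕ) ↔ j < x := by
  rw [Equiv.swap_apply_def]
  split_ifs with h1 h2
  · subst h1; exact iff_of_true hv hu
  · subst h2; exact iff_of_true hu hv
  · rfl

lemma card_firstExceedsAt_le {n k M j : ℕ} {u v : Fin n} (hu : j < u) (hv : j < v) :
    ((firstMaxEq n k M j).filter (fun w => firstExceedsAt n k M w u)).card ≤
      ((firstMaxEq n k M j).filter (fun w => firstExceedsAt n k M w v)).card := by
  refine card_le_card_of_injOn (fun w => Equiv.swap u v ∘ w) ?_ ?_
  · intro w hw
    simp only [firstMaxEq, coe_filter, mem_filter, Set.mem_ofPred_eq] at hw ⊢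
    obtain ⟨⟨hw, rfl⟩, i, hMi, hi, hmin, rfl⟩ := hw
    have hmax := firstMax_swap_comp w hu hv
    refine ⟨⟨multisetPerms_perm_comp hw _, hmax⟩, i, hMi, ?_, ?_, ?_⟩
    · rw [hmax]
      exact (lt_swap_iff hu hv _).2 hi
    · intro i' hi' hlt
      rw [hmax] at hlt
      exact hmin i' hi' ((lt_swap_iff hu hv _).1 hlt)
    · simp
  · intro w _ w' _ hww
    exact (Equiv.swap u v).injective.comp_left hww

lemma existsUnique_firstExceedsAt {n k M : ℕ} (hk : 1 ≤ k) {w : Fin (k*n) → Fin n}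
    (hw : w ∈ multisetPerms n k) (hlt : firstMax n k M w + 1 < n) :
    ∃! v, firstExceedsAt n k M w v := by
  obtain ⟨i₀, hi₀⟩ : (univ.filter (fun i => w i = ⟨n - 1, by omega⟩)).Nonempty := by
    rw [← card_pos, mem_multisetPerms.1 hw]
    exact hk
  have hval : (w i₀ : ℕ) = n - 1 := by
    rw [mem_filter] at hi₀
    rw [hi₀.2]
  have hne : (univ.filter
      (fun i : Fin (k*n) => M ≤ (i : ℕ) ∧ firstMax n k M w < (w i : ℕ))).Nonempty := by
    refine ⟨i₀, ?_⟩
    rw [mem_filter]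
    refine ⟨mem_univ _, ?_, by omega⟩
    by_contra hcon
    have := le_firstMax w (i := i₀) (M := M) (by omega)
    omega
  obtain ⟨i, hi, hmin⟩ := exists_min_image _ id hne
  simp only [mem_filter, mem_univ, true_and] at hi hmin
  refine ⟨w i, ⟨i, hi.1, hi.2, fun i' h1 h2 => hmin i' ⟨h1, h2⟩, rfl⟩, ?_⟩
  rintro _ ⟨i', h1, h2, h3, rfl⟩
  rw [le_antisymm (h3 i hi.1 hi.2) (hmin i' ⟨h1, h2⟩)]

lemma card_firstMaxEq_eq_mul {n k M j r : ℕ} (hk : 1 ≤ k) (h : j + r + 1 = n) (hr : 1 ≤ r) :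
    (firstMaxEq n k M j).card =
      r * ((firstMaxEq n k M j).filter (succeedsSplus n k M)).card := by
  have hT : (Ioi (⟨j, by omega⟩ : Fin n)).card = r := by
    rw [Fin.card_Ioi]
    simp only
    omega
  have hlast : (firstMaxEq n k M j).filter (succeedsSplus n k M) =
      (firstMaxEq n k M j).filter (fun w => firstExceedsAt n k M w ⟨n - 1, by omega⟩) := by
    refine filter_congr fun w _ => ?_
    simp only [succeedsSplus, firstExceedsAt, Fin.ext_iff]
    refine exists_congr fun i => ?_
    have : (w i : ℕ) + 1 = n ↔ (w i : ℕ) = n - 1 := by omega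
    rw [this]
  have key := sum_card_bipartiteAbove_eq_sum_card_bipartiteBelow
    (s := firstMaxEq n k M j) (t := Ioi (⟨j, by omega⟩ : Fin n)) (firstExceedsAt n k M)
  rw [sum_congr rfl (g := fun _ => 1), sum_congr (s₁ := Ioi (⟨j, by omega⟩ : Fin n)) rfl
    (g := fun _ => ((firstMaxEq n k M j).filter (succeedsSplus n k M)).card)] at key
  · simpa [hT] using key
  · intro v hv
    rw [mem_Ioi, Fin.lt_def] at hv
    simp only at hv
    rw [hlast]
    exact le_antisymm (card_firstExceedsAt_le hv (by simp only; omega))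
      (card_firstExceedsAt_le (by simp only; omega) hv)
  · intro w hw
    simp only [firstMaxEq, mem_filter] at hw
    obtain ⟨v, hv, huniq⟩ := existsUnique_firstExceedsAt (M := M) hk hw.1 (by omega)
    rw [card_eq_one]
    refine ⟨v, ?_⟩
    ext x
    simp only [bipartiteAbove, mem_filter, mem_singleton, mem_Ioi, Fin.lt_def]
    constructor
    · exact fun hx => huniq x hx.2
    · rintro rfl
      refine ⟨?_, hv⟩
      obtain ⟨i, -, hi, -, rfl⟩ := hv
      omega

lemma probSplus_eq_sum {n k M : ℕ} (hk : 1 ≤ k) (hM : 1 ≤ M) (hM' : M ≤ k*n) :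
    probSplus n k M = ∑ s ∈ range (n - 1),
      (avoidProb n k M (s + 1) - avoidProb n k M (s + 2)) / ((s : ℝ) + 1) := by
  have hpos : ((multisetPerms n k).card : ℝ) ≠ 0 := by
    exact_mod_cast (multisetPerms_nonempty n k).card_pos.ne'
  rw [probSplus, div_eq_iff hpos, sum_mul,
    card_eq_sum_card_fiberwise (f := fun w => n - 2 - firstMax n k M w) (t := range (n - 1))]
  · push_cast
    refine sum_congr rfl fun s hs => ?_
    rw [mem_range] at hs
    have h1 := card_firstMaxEq_eq_mul (n := n) (M := M) (j := n - 2 - s) (r := s + 1) hk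
      (by omega) (by omega)
    have h2 := card_firstMaxEq (n := n) (j := n - 2 - s) (r := s + 1) hM hM' (by omega)
    have h3 : ((multisetPerms n k).filter (succeedsSplus n k M)).filter
        (fun w => n - 2 - firstMax n k M w = s) =
        (firstMaxEq n k M (n - 2 - s)).filter (succeedsSplus n k M) := by
      ext w
      simp only [firstMaxEq, mem_filter]
      constructor
      · rintro ⟨⟨h1, h2⟩, h3⟩
        obtain ⟨i, -, hi, -, hi'⟩ := id h2
        exact ⟨⟨h1, by omega⟩, h2⟩
      · rintro ⟨⟨h1, h2⟩, h3⟩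
        exact ⟨⟨h1, h3⟩, by omega⟩
    rw [h3]
    rw [h1] at h2
    push_cast at h2
    have : (s : ℝ) + 1 ≠ 0 := by positivity
    rw [div_mul_eq_mul_div, eq_div_iff this]
    linarith
  · intro w hw
    simp only [coe_filter, Set.mem_ofPred_eq] at hw
    obtain ⟨-, i, -, hi, -, hi'⟩ := hw
    simp only [coe_range, Set.mem_Iio]
    omega

lemma avoidProb_eq_prod (n k M r : ℕ) :
    avoidProb n k M r =
      ∏ i ∈ range (k*r), ((k*n - M - i : ℕ) : ℝ) / ((k*n - i : ℕ) : ℝ) := by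
  have h : ((k*r).factorial : ℝ) ≠ 0 := by exact_mod_cast (Nat.factorial_pos _).ne'
  rw [prod_div_distrib, avoidProb, ← mul_div_mul_left _ _ h]
  simp only [← Nat.cast_prod, ← Nat.descFactorial_eq_prod_range,
    Nat.descFactorial_eq_factorial_mul_choose, Nat.cast_mul]

lemma avoidProb_nonneg (n k M r : ℕ) : 0 ≤ avoidProb n k M r := by
  unfold avoidProb; positivity

lemma avoidProb_eq_zero {n k M r : ℕ} (hk : 1 ≤ k) (hM : 1 ≤ M) (hr : n ≤ r) (hr0 : 1 ≤ r) :
    avoidProb n k M r = 0 := by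
  rw [avoidProb]
  have h0 : 0 < k * r := Nat.mul_pos hk hr0
  have : k * n ≤ k * r := Nat.mul_le_mul_left k hr
  rw [Nat.choose_eq_zero_of_lt (by omega)]
  simp

lemma avoidProb_le_pow (n k M r : ℕ) :
    avoidProb n k M r ≤ (((k*n - M : ℕ) : ℝ) / ((k*n : ℕ) : ℝ)) ^ (k*r) := by
  rw [avoidProb_eq_prod, ← card_range (k*r), ← prod_const, card_range]
  refine prod_le_prod (fun i _ => by positivity) fun i _ => ?_
  rcases le_or_gt (k*n - M) i with h | h
  · rw [Nat.sub_eq_zero_of_le h]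
    simp only [Nat.cast_zero, zero_div]
    positivity
  · have hb : i < k*n := by omega
    rw [div_le_div_iff₀ (by exact_mod_cast (by omega : 0 < k*n - i))
      (by exact_mod_cast (by omega : 0 < k*n)), Nat.cast_sub h.le, Nat.cast_sub hb.le]
    have h1 : ((k*n - M : ℕ) : ℝ) ≤ ((k*n : ℕ) : ℝ) := by exact_mod_cast Nat.sub_le _ _
    have h2 : (0:ℝ) ≤ i := by positivity
    nlinarith

lemma tendsto_avoidProb {k : ℕ} (hk : 1 ≤ k) {M : ℕ → ℕ} {c : ℝ}
    (h : Tendsto (fun n => ((k*n - M n : ℕ) : ℝ) / ((k*n : ℕ) : ℝ)) atTop (nhds (1 - c)))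
    (hc : 0 < 1 - c) (r : ℕ) :
    Tendsto (fun n => avoidProb n k (M n) r) atTop (nhds ((1 - c) ^ (k*r))) := by
  simp only [avoidProb_eq_prod]
  rw [← card_range (k*r), ← prod_const, card_range]
  refine tendsto_finsetProd _ fun i _ => ?_
  have hb : Tendsto (fun n : ℕ => ((k*n : ℕ) : ℝ)) atTop atTop :=
    tendsto_natCast_atTop_atTop.comp (tendsto_id.const_mul_atTop' hk)
  have hi : Tendsto (fun n : ℕ => (i : ℝ) / ((k*n : ℕ) : ℝ)) atTop (nhds 0) :=
    hb.const_div_atTop _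
  have hlim := (h.sub hi).div (tendsto_const_nhds (x := (1:ℝ)) |>.sub hi) (by norm_num)
  simp only [sub_zero, div_one] at hlim
  refine hlim.congr' ?_
  filter_upwards [hb.eventually_gt_atTop (i : ℝ),
    (h.sub hi).eventually (lt_mem_nhds (show (0:ℝ) < 1 - c - 0 by simpa using hc))] with n hn hn'
  have hn0 : (0:ℝ) < ((k*n : ℕ) : ℝ) := lt_of_le_of_lt (by positivity) hn
  simp only [Pi.div_apply]
  rw [← sub_div, div_pos_iff_of_pos_right hn0, sub_pos, Nat.cast_lt] at hn'
  rw [Nat.cast_lt] at hn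
  rw [Nat.cast_sub hn'.le, Nat.cast_sub hn.le, ← sub_div]
  have : (((k*n : ℕ) : ℝ) - i) ≠ 0 := sub_ne_zero.2 (by exact_mod_cast hn.ne')
  field_simp

/-- Theorem 2: the limiting success probability of `S⁺(n,k;M_n)` when `M_n/(kn) → c`. -/
theorem secretary_multirank_limit_plus (k : ℕ) (hk : 2 ≤ k) (c : ℝ)
    (hc : c ∈ Set.Ioo (0:ℝ) 1)
    (M : ℕ → ℕ) (hM : ∀ n, 1 ≤ n → 1 ≤ M n ∧ M n ≤ k*n - 1)
    (hlim : Tendsto (fun n : ℕ => (M n : ℝ) / ((k : ℝ) * n)) atTop (nhds c)) :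
    Tendsto (fun n : ℕ => probSplus n k (M n)) atTop
      (nhds (-(1 - (1-c)^k) * Real.log (1 - (1-c)^k))) := by
  obtain ⟨hc0, hc1⟩ := hc
  have hratio : Tendsto (fun n => ((k*n - M n : ℕ) : ℝ) / ((k*n : ℕ) : ℝ)) atTop
      (nhds (1 - c)) := by
    refine ((tendsto_const_nhds (x := (1:ℝ))).sub hlim).congr' ?_
    filter_upwards [eventually_ge_atTop 1] with n hn
    have hkn : 0 < k * n := by positivity
    have := (hM n hn).2
    rw [Nat.cast_sub (by omega), sub_div, div_self (by exact_mod_cast hkn.ne'), Nat.cast_mul]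
  obtain ⟨b, hb1, hb2⟩ := exists_between (show 1 - c < 1 by linarith)
  have hb0 : 0 < b := by linarith
  set q := (1 - c) ^ k with hq
  have hq0 : 0 < q := pow_pos (by linarith) k
  have hq1 : q < 1 := pow_lt_one₀ (by linarith) (by linarith) (by omega)
  have hbk : b ^ k < 1 := pow_lt_one₀ hb0.le hb2 (by omega)
  have hsum : HasSum (fun s : ℕ => (q ^ (s + 1) - q ^ (s + 2)) / ((s : ℝ) + 1))
      (-(1 - q) * Real.log (1 - q)) := by
    have h := (Real.hasSum_pow_div_log_of_abs_lt_one
      (by rw [abs_of_pos hq0]; exact hq1)).mul_left (1 - q)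
    rw [mul_neg, ← neg_mul] at h
    have hterm : (fun s : ℕ => (q ^ (s + 1) - q ^ (s + 2)) / ((s : ℝ) + 1)) =
        fun s : ℕ => (1 - q) * (q ^ (s + 1) / ((s : ℝ) + 1)) := by
      funext s
      ring
    rwa [hterm]
  rw [← hsum.tsum_eq]
  have hdom : Tendsto (fun n => ∑' s : ℕ,
      (avoidProb n k (M n) (s + 1) - avoidProb n k (M n) (s + 2)) / ((s : ℝ) + 1)) atTop
      (nhds (∑' s : ℕ, (q ^ (s + 1) - q ^ (s + 2)) / ((s : ℝ) + 1))) := by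
    refine tendsto_tsum_of_dominated_convergence (bound := fun s => (b ^ k) ^ s)
      (summable_geometric_of_lt_one (by positivity) hbk) (fun s => ?_) ?_
    · simp only [hq, ← pow_mul]
      exact ((tendsto_avoidProb (by omega) hratio (by linarith) _).sub
        (tendsto_avoidProb (by omega) hratio (by linarith) _)).div_const _
    · filter_upwards [hratio.eventually (gt_mem_nhds hb1)] with n hn s
      have hle : ∀ r, s ≤ r → avoidProb n k (M n) r ≤ (b ^ k) ^ s := fun r hr => by
        calc avoidProb n k (M n) r ≤ _ := avoidProb_le_pow n k (M n) r
          _ ≤ b ^ (k*r) := by gcongr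
          _ = (b ^ k) ^ r := pow_mul _ _ _
          _ ≤ (b ^ k) ^ s := pow_le_pow_of_le_one (by positivity) hbk.le hr
      rw [norm_div, Real.norm_eq_abs, Real.norm_eq_abs,
        abs_of_pos (by positivity : (0:ℝ) < (s:ℝ) + 1)]
      refine (div_le_self (abs_nonneg _) (by linarith [s.cast_nonneg (α := ℝ)])).trans ?_
      have h1 := hle (s + 1) (by omega)
      have h2 := hle (s + 2) (by omega)
      have h3 := avoidProb_nonneg n k (M n) (s + 1)
      have h4 := avoidProb_nonneg n k (M n) (s + 2)
      rw [abs_le]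
      constructor <;> linarith
  refine hdom.congr' ?_
  filter_upwards [eventually_ge_atTop 1] with n hn
  obtain ⟨h1, h2⟩ := hM n hn
  rw [probSplus_eq_sum (by omega) h1 (by omega)]
  refine tsum_eq_sum fun s hs => ?_
  rw [mem_range, not_lt] at hs
  rw [avoidProb_eq_zero (by omega) h1 (by omega) (by omega), avoidProb_eq_zero (by omega) h1 (by omega) (by omega)]
  simp
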